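/- Let Y = (0,1)², N a positive integer, h = 1/N, 𝒯_h the uniform triangulation of Y into 2N² triangles obtained by dividing each square [ih,(i+1)h] × [jh,(j+1)h] along the diagonal from (ih,jh) to ((i+1)h,(j+1)h), and for 0 < δ ≤ h let K_δ be the homothety of K ∈ 𝒯_h about its barycenter with ratio δ/h. Let φ^{ij}(x) = max(0, 1 − max(|x₁/h − i|, |x₂/h − j|, |(x₁ − x₂)/h − (i − j)|)) and I = {1,…,N−1}². Let 0 < α < 2 and κ > 0, let (Ω, ℱ, ℙ) be a probability space, q : ℝ² × Ω → ℝ jointly measurable, uniformly bounded, with E q(x,·) = 0 and E[q(x,·)q(y,·)] = R(x−y) for all x, y ∈ ℝ², where |R(z)| ≤ κ |z|^{−α} for all z ≠ 0. Let q₀ : Y → ℝ be bounded measurable with q₀ ≥ 0 and, for a fixed ε > 0, assume q₀(x) + q(x/ε, ω) ≥ 0 for a.e. x ∈ Y and ℙ-a.e. ω. For integrable Q : Y → ℝ define A^Q_{ij,kl} = Σ_{K ∈ 𝒯_h} (|K|/|K_δ|) ∫_{K_δ} (∇φ^{ij}·∇φ^{kl} + Q φ^{ij} φ^{kl}) dx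 on I × I; set A^ε(ω) = A^{q₀ + q(·/ε,ω)}, A⁰ = A^{q₀}. Let f : Y → ℝ be bounded measurable, F_{ij} = ∫_Y f φ^{ij} dx, and let U^ε(ω), U⁰ ∈ ℝ^I solve A^ε(ω) U^ε(ω) = F and A⁰ U⁰ = F; let G = (A⁰)^{−1}. Define d⁻₁(i,j) = (i−1,j), d⁻₂(i,j) = (i,j−1), d⁻₃(i,j) = (i−1,j−1), and for V ∈ ℝ^I set D⁻_s V_{ij} = V_{ij} − V_{d⁻_s ij} with the convention V_{kl} = 0 for kl ∉ I; D⁻_s acts on G in its second index pair. Suppose there exist C > 0 and γ₁, γ₂, γ₃, γ₄ ∈ ℝ (possibly negative) such that almost surely, for all s = 1,2,3 and all ij, kl ∈ I, |D⁻_s G_{ij,kl}| ≤ C h^{γ₁}, |D⁻_s U^ε_{ij}| ≤ C h^{γ₂}, |G_{ij,kl}| ≤ C h^{γ₃} and |U^ε_{ij}| ≤ C h^{γ₄}. Then there is a constant C′ depending only on C, α and κ (not on h, δ or ε) such that E ‖U^ε − U⁰‖²_{ℓ²} ≤ C′ h^{2 min(γ₁+γ₂, γ₃+γ₄) − 2}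 (ε/δ)^α, where ‖V‖²_{ℓ²} = Σ_{ij ∈ I} V_{ij}². -/

import Mathlib

noncomputable section
open MeasureTheory

/-- Closed triangle of the uniform triangulation of the unit square: for
`0 ≤ i, j ≤ N−1`, `tri h i j true` is the lower triangle with vertices
`(ih, jh), ((i+1)h, jh), ((i+1)h, (j+1)h)` and `tri h i j false` the upper triangle
with vertices `(ih, jh), (ih, (j+1)h), ((i+1)h, (j+1)h)`. -/
def tri (h : ℝ) (i j : ℕ) (lower : Bool) : Set (ℝ × ℝ) :=
  if lower then
    convexHull ℝ {((i * h, j * h) : ℝ × ℝ), ((i + 1) * h, j * h), ((i + 1) * h, (j + 1) * h)}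
  else
    convexHull ℝ {((i * h, j * h) : ℝ × ℝ), (i * h, (j + 1) * h), ((i + 1) * h, (j + 1) * h)}

/-- The barycenter of the triangle `tri h i j lower`. -/
def bary (h : ℝ) (i j : ℕ) (lower : Bool) : ℝ × ℝ :=
  if lower then ((3 * i + 2) / 3 * h, (3 * j + 1) / 3 * h)
  else ((3 * i + 1) / 3 * h, (3 * j + 2) / 3 * h)

/-- The patch `K_δ`: the image of the triangle `K = tri h i j lower` under the
homothety with center the barycenter of `K` and ratio `δ/h`. -/
def patch (h δ : ℝ) (i j : ℕ) (lower : Bool) : Set (ℝ × ℝ) :=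
  (AffineMap.homothety (bary h i j lower) (δ / h)) '' (tri h i j lower)

/-- The P1 hat (nodal basis) function at the node `(i h, j h)`. -/
def hat (h : ℝ) (p : ℤ × ℤ) (x : ℝ × ℝ) : ℝ :=
  max 0 (1 - max |x.1 / h - (p.1 : ℝ)|
    (max |x.2 / h - (p.2 : ℝ)| |(x.1 - x.2) / h - ((p.1 : ℝ) - (p.2 : ℝ))|))

/-- Dot product of the gradients of two functions (via the Fréchet derivative; for
piecewise affine functions this is the piecewise constant gradient a.e.). -/
def gradDot (f g : ℝ × ℝ → ℝ) (x : ℝ × ℝ) : ℝ :=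
  fderiv ℝ f x (1, 0) * fderiv ℝ g x (1, 0) + fderiv ℝ f x (0, 1) * fderiv ℝ g x (0, 1)

/-- The HMM stiffness matrix with potential `Q`:
`A^Q_{p,r} = Σ_{K ∈ 𝒯_h} (|K|/|K_δ|) ∫_{K_δ} (∇φ^p·∇φ^r + Q φ^p φ^r)`. -/
def stiff (h δ : ℝ) (N : ℕ) (Q : ℝ × ℝ → ℝ) (p r : ℤ × ℤ) : ℝ :=
  ∑ t : Fin N × Fin N × Bool,
    (volume (tri h t.1 t.2.1 t.2.2)).toReal / (volume (patch h δ t.1 t.2.1 t.2.2)).toReal *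
      ∫ x in patch h δ t.1 t.2.1 t.2.2,
        (gradDot (hat h p) (hat h r) x + Q x * hat h p x * hat h r x)

/-- The interior nodes `I = {1, …, N−1}²`. -/
def nodes (N : ℕ) : Finset (ℤ × ℤ) := Finset.Icc 1 ((N : ℤ) - 1) ×ˢ Finset.Icc 1 ((N : ℤ) - 1)

/-- Backward neighbor maps `d^-_s`, `s = 1, 2, 3` (horizontal, vertical, diagonal). -/
def dm (s : Fin 3) (p : ℤ × ℤ) : ℤ × ℤ :=
  if s = 0 then (p.1 - 1, p.2) else if s = 1 then (p.1, p.2 - 1) else (p.1 - 1, p.2 - 1)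

/-- The unit square `Y = (0,1)²`. -/
def Ysq : Set (ℝ × ℝ) := Set.Ioo (0 : ℝ) 1 ×ˢ Set.Ioo (0 : ℝ) 1

/-- The load vector `F_{ij} = ∫_Y f φ^{ij}`. -/
def load (h : ℝ) (f : ℝ × ℝ → ℝ) (p : ℤ × ℤ) : ℝ := ∫ x in Ysq, f x * hat h p x

lemma measurable_hat (h : ℝ) (p : ℤ × ℤ) : Measurable (hat h p) := by
  unfold hat
  fun_prop

lemma hat_nonneg (h : ℝ) (p : ℤ × ℤ) (x : ℝ × ℝ) : 0 ≤ hat h p x := le_max_left _ _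

lemma hat_le_one (h : ℝ) (p : ℤ × ℤ) (x : ℝ × ℝ) : hat h p x ≤ 1 := by
  unfold hat
  refine max_le zero_le_one ?_
  have := (abs_nonneg (x.1 / h - (p.1 : ℝ))).trans (le_max_left _
    (max |x.2 / h - (p.2 : ℝ)| |(x.1 - x.2) / h - ((p.1 : ℝ) - (p.2 : ℝ))|))
  linarith

/-- A hat function vanishes as soon as one coordinate is at distance at least `h` from the
node. -/
lemma hat_eq_zero {h : ℝ} {p : ℤ × ℤ} {x : ℝ × ℝ}
    (hx : 1 ≤ |x.1 / h - (p.1 : ℝ)| ∨ 1 ≤ |x.2 / h - (p.2 : ℝ)|) : hat h p x = 0 := by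
  unfold hat
  refine max_eq_left (sub_nonpos.2 ?_)
  rcases hx with hx | hx
  · exact hx.trans (le_max_left _ _)
  · exact hx.trans ((le_max_left _ _).trans (le_max_right _ _))

lemma isCompact_tri (h : ℝ) (i j : ℕ) (b : Bool) : IsCompact (tri h i j b) := by
  unfold tri
  split_ifs <;> exact (Set.toFinite _).isCompact_convexHull ℝ

lemma isCompact_patch (h δ : ℝ) (i j : ℕ) (b : Bool) : IsCompact (patch h δ i j b) :=
  (isCompact_tri h i j b).image (AffineMap.homothety_continuous _ _)

lemma tri_subset {h : ℝ} (hh : 0 ≤ h) (i j : ℕ) (b : Bool) :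
    tri h i j b ⊆ Set.Icc (i * h) ((i + 1) * h) ×ˢ Set.Icc (j * h) ((j + 1) * h) := by
  have hconv : Convex ℝ (Set.Icc (i * h) ((i + 1) * h) ×ˢ Set.Icc (j * h) ((j + 1) * h)) :=
    (convex_Icc _ _).prod (convex_Icc _ _)
  have hi : (i : ℝ) * h ≤ (i + 1) * h := by nlinarith
  have hj : (j : ℝ) * h ≤ (j + 1) * h := by nlinarith
  unfold tri
  split_ifs
  all_goals
    refine convexHull_min ?_ hconv
    rintro x (rfl | rfl | rfl) <;> simp [hi, hj]

/-- A patch lies in the cell of its triangle. -/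
lemma patch_subset_cell {h δ : ℝ} (hh : 0 < h) (hδ : 0 < δ) (hδh : δ ≤ h) (i j : ℕ) (b : Bool) :
    patch h δ i j b ⊆ Set.Icc (i * h) ((i + 1) * h) ×ˢ Set.Icc (j * h) ((j + 1) * h) := by
  rintro _ ⟨y, hy, rfl⟩
  have hconv : Convex ℝ (Set.Icc (i * h) ((i + 1) * h) ×ˢ Set.Icc (j * h) ((j + 1) * h)) :=
    (convex_Icc _ _).prod (convex_Icc _ _)
  have hb : bary h i j b ∈ Set.Icc (i * h) ((i + 1) * h) ×ˢ Set.Icc (j * h) ((j + 1) * h) := by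
    unfold bary
    split_ifs <;> refine ⟨⟨?_, ?_⟩, ⟨?_, ?_⟩⟩ <;> simp only <;> nlinarith
  rw [AffineMap.homothety_eq_lineMap]
  exact hconv.lineMap_mem hb (tri_subset hh.le i j b hy)
    ⟨by positivity, (div_le_one hh).2 hδh⟩

/-- A patch lies in the square of half-side `δ` around its barycenter. -/
lemma patch_subset_box {h δ : ℝ} (hh : 0 < h) (hδ : 0 < δ) (i j : ℕ) (b : Bool) :
    patch h δ i j b ⊆
      Set.Icc ((bary h i j b).1 - δ) ((bary h i j b).1 + δ) ×ˢ
        Set.Icc ((bary h i j b).2 - δ) ((bary h i j b).2 + δ) := by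
  rintro _ ⟨y, hy, rfl⟩
  obtain ⟨⟨h1, h2⟩, ⟨h3, h4⟩⟩ := tri_subset hh.le i j b hy
  have hb : |y.1 - (bary h i j b).1| ≤ h ∧ |y.2 - (bary h i j b).2| ≤ h := by
    unfold bary
    split_ifs <;> refine ⟨abs_le.2 ⟨?_, ?_⟩, abs_le.2 ⟨?_, ?_⟩⟩ <;> simp only <;> nlinarith
  have key : ∀ u : ℝ, |u| ≤ h → |δ / h * u| ≤ δ := fun u hu => by
    rw [abs_mul, abs_of_pos (div_pos hδ hh), div_mul_eq_mul_div, div_le_iff₀ hh]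
    exact mul_le_mul_of_nonneg_left hu hδ.le
  have k1 := abs_le.1 (key _ hb.1)
  have k2 := abs_le.1 (key _ hb.2)
  simp only [AffineMap.homothety_apply, vsub_eq_sub, vadd_eq_add, Set.mem_prod, Set.mem_Icc,
    Prod.fst_add, Prod.snd_add, Prod.smul_fst, Prod.smul_snd, Prod.fst_sub, Prod.snd_sub,
    smul_eq_mul]
  exact ⟨⟨by linarith, by linarith⟩, by linarith, by linarith⟩

lemma volume_patch_le {h δ : ℝ} (hh : 0 < h) (hδ : 0 < δ) (i j : ℕ) (b : Bool) :
    volume.real (patch h δ i j b) ≤ 4 * δ ^ 2 := by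
  refine (measureReal_mono (patch_subset_box hh hδ i j b) ?_).trans_eq ?_
  · exact (isCompact_Icc.prod isCompact_Icc).measure_lt_top.ne
  · rw [Measure.volume_eq_prod, measureReal_prod_prod, Real.volume_real_Icc_of_le (by linarith),
      Real.volume_real_Icc_of_le (by linarith)]
    ring

lemma volume_ratio_nonneg (h δ : ℝ) (i j : ℕ) (b : Bool) :
    0 ≤ (volume (tri h i j b)).toReal / (volume (patch h δ i j b)).toReal := by positivity

lemma volume_ratio_le {h δ : ℝ} (hh : 0 < h) (hδ : 0 < δ) (i j : ℕ) (b : Bool) :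
    (volume (tri h i j b)).toReal / (volume (patch h δ i j b)).toReal ≤ (h / δ) ^ 2 := by
  have hv : (volume (patch h δ i j b)).toReal = (δ / h) ^ 2 * (volume (tri h i j b)).toReal := by
    unfold patch
    rw [Measure.addHaar_image_homothety, ENNReal.toReal_mul, ENNReal.toReal_ofReal (abs_nonneg _)]
    simp [Module.finrank_prod]
  rw [hv]
  rcases eq_or_ne (volume (tri h i j b)).toReal 0 with h0 | h0
  · rw [h0]; simp; positivity
  · apply le_of_eq
    field_simp

/-- The vertices of the cell with lower left corner `(i h, j h)`. -/
def cellNodes (i j : ℕ) : Finset (ℤ × ℤ) := {(i : ℤ), (i : ℤ) + 1} ×ˢ {(j : ℤ), (j : ℤ) + 1}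

lemma card_cellNodes (i j : ℕ) : (cellNodes i j).card = 4 := by
  simp [cellNodes]

lemma one_le_abs_sub_of_ne {a : ℝ} {i : ℕ} {m : ℤ} (ha : a ∈ Set.Icc (i : ℝ) (i + 1))
    (h0 : m ≠ i) (h1 : m ≠ i + 1) : 1 ≤ |a - m| := by
  have : m + 1 ≤ i ∨ (i : ℤ) + 2 ≤ m := by omega
  rcases this with hm | hm
  · have : (m : ℝ) + 1 ≤ i := by exact_mod_cast hm
    exact le_abs.2 (Or.inl (by linarith [ha.1]))
  · have : (i : ℝ) + 2 ≤ m := by exact_mod_cast hm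
    exact le_abs.2 (Or.inr (by linarith [ha.2]))

lemma hat_eq_zero_on_patch {h δ : ℝ} (hh : 0 < h) (hδ : 0 < δ) (hδh : δ ≤ h) {i j : ℕ} {b : Bool}
    {p : ℤ × ℤ} (hp : p ∉ cellNodes i j) {x : ℝ × ℝ} (hx : x ∈ patch h δ i j b) :
    hat h p x = 0 := by
  obtain ⟨⟨h1, h2⟩, ⟨h3, h4⟩⟩ := patch_subset_cell hh hδ hδh i j b hx
  simp only [cellNodes, Finset.mem_product, Finset.mem_insert, Finset.mem_singleton,
    not_and_or, not_or] at hp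
  apply hat_eq_zero
  rcases hp with hp | hp
  · exact Or.inl (one_le_abs_sub_of_ne ⟨(le_div_iff₀ hh).2 h1, (div_le_iff₀ hh).2 h2⟩ hp.1 hp.2)
  · exact Or.inr (one_le_abs_sub_of_ne ⟨(le_div_iff₀ hh).2 h3, (div_le_iff₀ hh).2 h4⟩ hp.1 hp.2)

/-- Adding an integrable function changes a Bochner integral by at most the absolute value of
its integral, whether or not the first function is integrable. -/
lemma abs_integral_add_sub_le {X : Type*} [MeasurableSpace X] {μ : Measure X} {f g : X → ℝ}
    (hg : Integrable g μ) :
    |(∫ x, (f x + g x) ∂μ) - ∫ x, f x ∂μ| ≤ |∫ x, g x ∂μ| := by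
  by_cases hf : Integrable f μ
  · rw [integral_add hf hg, add_sub_cancel_left]
  · have hfg : ¬ Integrable (fun x => f x + g x) μ := fun hfg =>
      hf (by simpa [Pi.sub_def] using hfg.sub hg)
    rw [integral_undef hf, integral_undef hfg]
    simp

/-- The one-dimensional truncated Riesz kernel. -/
def truncKernel (β a s : ℝ) : ℝ := (Set.Iic a).indicator (fun r : ℝ => r ^ (-β)) |s|

lemma truncKernel_nonneg (β a s : ℝ) : 0 ≤ truncKernel β a s :=
  Set.indicator_apply_nonneg fun _ => Real.rpow_nonneg (abs_nonneg s) _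

lemma integrable_truncKernel {β a : ℝ} (hβ : β < 1) (ha : 0 < a) :
    Integrable (truncKernel β a) := by
  have h1 : IntegrableOn (fun r : ℝ => r ^ (-β)) (Set.Ioc 0 a) :=
    (intervalIntegrable_iff_integrableOn_Ioc_of_le ha.le).1
      (intervalIntegral.intervalIntegrable_rpow' (by linarith))
  have h2 : Integrable ((Set.Ioc 0 a).indicator fun r : ℝ => r ^ (-β)) :=
    (integrable_indicator_iff measurableSet_Ioc).2 h1
  refine (h2.add h2.comp_neg).congr ?_
  filter_upwards [(Set.finite_singleton (0 : ℝ)).countable.ae_notMem volume] with s hs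
  rcases lt_or_gt_of_ne (show s ≠ 0 from hs) with h | h
  · simp [truncKernel, Set.indicator, h, h.le, abs_of_neg]
  · simp [truncKernel, Set.indicator, h, h.le, abs_of_pos]

lemma integral_truncKernel {β a : ℝ} (hβ : β < 1) (ha : 0 < a) :
    ∫ s, truncKernel β a s = 2 * (a ^ (1 - β) / (1 - β)) := by
  unfold truncKernel
  rw [integral_comp_abs (f := (Set.Iic a).indicator fun r : ℝ => r ^ (-β)),
    setIntegral_indicator measurableSet_Iic, Set.Ioi_inter_Iic,
    ← intervalIntegral.integral_of_le ha.le, integral_rpow (Or.inl (by linarith)),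
    Real.zero_rpow (by linarith)]
  ring_nf

/-- Planar Riesz kernels are dominated by products of one-dimensional ones. -/
lemma sqrt_rpow_neg_le {α u v : ℝ} (hα : 0 ≤ α) (hu : u ≠ 0) (hv : v ≠ 0) :
    Real.sqrt (u ^ 2 + v ^ 2) ^ (-α) ≤ |u| ^ (-(α / 2)) * |v| ^ (-(α / 2)) := by
  have h1 : 0 < |u| * |v| := mul_pos (abs_pos.2 hu) (abs_pos.2 hv)
  have h2 : |u| * |v| ≤ u ^ 2 + v ^ 2 := by
    rw [← sq_abs u, ← sq_abs v]
    nlinarith [sq_nonneg (|u| - |v|)]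
  rw [Real.sqrt_eq_rpow, ← Real.rpow_mul (by positivity),
    ← Real.mul_rpow (abs_nonneg _) (abs_nonneg _)]
  have : 1 / 2 * -α = -(α / 2) := by ring
  rw [this]
  exact Real.rpow_le_rpow_of_nonpos h1 h2 (by linarith)

lemma ae_fst_ne_and_snd_ne (x : ℝ × ℝ) : ∀ᵐ y : ℝ × ℝ, x.1 ≠ y.1 ∧ x.2 ≠ y.2 := by
  have h1 : ∀ᵐ s : ℝ, x.1 ≠ s := by
    filter_upwards [(Set.finite_singleton x.1).countable.ae_notMem volume] with s hs h
    exact hs h.symm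
  have h2 : ∀ᵐ s : ℝ, x.2 ≠ s := by
    filter_upwards [(Set.finite_singleton x.2).countable.ae_notMem volume] with s hs h
    exact hs h.symm
  rw [Measure.volume_eq_prod]
  filter_upwards [Measure.quasiMeasurePreserving_fst.ae h1,
    Measure.quasiMeasurePreserving_snd.ae h2] with y a b using ⟨a, b⟩

/-- Integrating a heavy-tailed correlation function over a set of diameter of order `δ`. -/
lemma setIntegral_abs_correlation_le {α κ ε δ : ℝ} {R : ℝ × ℝ → ℝ} (hα0 : 0 < α) (hα2 : α < 2)
    (hκ : 0 < κ)
    (hR : ∀ z : ℝ × ℝ, z ≠ 0 → |R z| ≤ κ * Real.sqrt (z.1 ^ 2 + z.2 ^ 2) ^ (-α))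
    (hε : 0 < ε) (hδ : 0 < δ) {P : Set (ℝ × ℝ)} (hP : MeasurableSet P) {c x : ℝ × ℝ}
    (hPc : P ⊆ Set.Icc (c.1 - δ) (c.1 + δ) ×ˢ Set.Icc (c.2 - δ) (c.2 + δ)) (hx : x ∈ P) :
    ∫ y in P, |R (ε⁻¹ • x - ε⁻¹ • y)| ≤
      16 * κ / (1 - α / 2) ^ 2 * ε ^ α * δ ^ (2 - α) := by
  set k : ℝ → ℝ := truncKernel (α / 2) (2 * δ) with hk
  have hβ : α / 2 < 1 := by linarith
  have ha : 0 < 2 * δ := by linarith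
  have hkint : Integrable k := integrable_truncKernel hβ ha
  have hprod : Integrable (fun y : ℝ × ℝ => k (x.1 - y.1) * k (x.2 - y.2)) := by
    rw [Measure.volume_eq_prod]
    exact (hkint.comp_sub_left x.1).mul_prod (hkint.comp_sub_left x.2)
  have hbound : ∀ᵐ y ∂(volume.restrict P),
      |R (ε⁻¹ • x - ε⁻¹ • y)| ≤ κ * ε ^ α * (k (x.1 - y.1) * k (x.2 - y.2)) := by
    filter_upwards [ae_restrict_mem hP, ae_restrict_of_ae (ae_fst_ne_and_snd_ne x)] with y hy hne
    obtain ⟨⟨a1, a2⟩, a3, a4⟩ := hPc hx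
    obtain ⟨⟨b1, b2⟩, b3, b4⟩ := hPc hy
    have e1 : k (x.1 - y.1) = |x.1 - y.1| ^ (-(α / 2)) :=
      Set.indicator_of_mem (Set.mem_Iic.2 (abs_le.2 ⟨by linarith, by linarith⟩)) _
    have e2 : k (x.2 - y.2) = |x.2 - y.2| ^ (-(α / 2)) :=
      Set.indicator_of_mem (Set.mem_Iic.2 (abs_le.2 ⟨by linarith, by linarith⟩)) _
    have n1 : x.1 - y.1 ≠ 0 := sub_ne_zero.2 hne.1
    have n2 : x.2 - y.2 ≠ 0 := sub_ne_zero.2 hne.2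
    have hε' : ε⁻¹ ≠ 0 := inv_ne_zero hε.ne'
    have hz : ε⁻¹ • x - ε⁻¹ • y = (ε⁻¹ * (x.1 - y.1), ε⁻¹ * (x.2 - y.2)) := by
      ext <;> simp [mul_sub]
    have hz0 : ((ε⁻¹ * (x.1 - y.1), ε⁻¹ * (x.2 - y.2)) : ℝ × ℝ) ≠ 0 := fun h0 =>
      mul_ne_zero hε' n1 (congrArg Prod.fst h0)
    have hscale : ∀ u : ℝ, |ε⁻¹ * u| ^ (-(α / 2)) = ε ^ (α / 2) * |u| ^ (-(α / 2)) := fun u => by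
      rw [abs_mul, Real.mul_rpow (abs_nonneg _) (abs_nonneg _), abs_of_pos (inv_pos.2 hε),
        Real.inv_rpow hε.le, Real.rpow_neg hε.le, inv_inv]
    have hεα : ε ^ α = ε ^ (α / 2) * ε ^ (α / 2) := by
      rw [← Real.rpow_add hε]; congr 1; ring
    rw [hz, e1, e2]
    refine (hR _ hz0).trans ?_
    refine (mul_le_mul_of_nonneg_left
      (sqrt_rpow_neg_le hα0.le (mul_ne_zero hε' n1) (mul_ne_zero hε' n2)) hκ.le).trans_eq ?_
    rw [hscale, hscale, hεα]
    ring
  calc ∫ y in P, |R (ε⁻¹ • x - ε⁻¹ • y)|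
      ≤ ∫ y in P, κ * ε ^ α * (k (x.1 - y.1) * k (x.2 - y.2)) :=
        integral_mono_of_nonneg (Filter.Eventually.of_forall fun _ => abs_nonneg _)
          (hprod.const_mul _).integrableOn hbound
    _ ≤ ∫ y : ℝ × ℝ, κ * ε ^ α * (k (x.1 - y.1) * k (x.2 - y.2)) := by
        refine setIntegral_le_integral (hprod.const_mul _) (Filter.Eventually.of_forall fun y => ?_)
        have := mul_nonneg (truncKernel_nonneg (α / 2) (2 * δ) (x.1 - y.1))
          (truncKernel_nonneg (α / 2) (2 * δ) (x.2 - y.2))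
        exact mul_nonneg (by positivity) this
    _ = κ * ε ^ α * (2 * ((2 * δ) ^ (1 - α / 2) / (1 - α / 2))) ^ 2 := by
        rw [integral_const_mul, Measure.volume_eq_prod,
          integral_prod_mul (fun s => k (x.1 - s)) (fun s => k (x.2 - s)),
          integral_sub_left_eq_self k, integral_sub_left_eq_self k,
          hk, integral_truncKernel hβ ha, sq]
    _ = 4 * κ / (1 - α / 2) ^ 2 * ε ^ α * (2 ^ (2 - α) * δ ^ (2 - α)) := by
        rw [← Real.mul_rpow zero_le_two hδ.le]
        have : (2 * δ) ^ (2 - α) = ((2 * δ) ^ (1 - α / 2)) ^ 2 := by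
          rw [← Real.rpow_natCast, ← Real.rpow_mul ha.le]; congr 1; push_cast; ring
        rw [this, mul_pow, div_pow]
        ring
    _ ≤ 4 * κ / (1 - α / 2) ^ 2 * ε ^ α * (4 * δ ^ (2 - α)) := by
        have : (2 : ℝ) ^ (2 - α) ≤ 4 := by
          calc (2 : ℝ) ^ (2 - α) ≤ 2 ^ (2 : ℝ) :=
                Real.rpow_le_rpow_of_exponent_le one_le_two (by linarith)
            _ = 4 := by norm_num
        gcongr
    _ = _ := by ring

section Moments

variable {Ω : Type} [MeasureSpace Ω]

lemma measurable_setIntegral_field {F : ℝ × ℝ → Ω → ℝ} {P : Set (ℝ × ℝ)}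
    (hF : Measurable (fun p : (ℝ × ℝ) × Ω => F p.1 p.2)) :
    Measurable fun ω => ∫ x in P, F x ω :=
  (StronglyMeasurable.integral_prod_left
    (f := fun x ω => F x ω) (μ := volume.restrict P) hF.stronglyMeasurable).measurable

lemma integrable_sq_setIntegral [IsProbabilityMeasure (volume : Measure Ω)]
    {F : ℝ × ℝ → Ω → ℝ} {M : ℝ} {P : Set (ℝ × ℝ)}
    (hP : IsCompact P) (hF : Measurable (fun p : (ℝ × ℝ) × Ω => F p.1 p.2))
    (hM : ∀ x ω, |F x ω| ≤ M) :
    Integrable fun ω => (∫ x in P, F x ω) ^ 2 := by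
  refine Integrable.of_bound ((measurable_setIntegral_field hF).pow_const 2).aestronglyMeasurable
    ((M * volume.real P) ^ 2) (Filter.Eventually.of_forall fun ω => ?_)
  rw [norm_pow]
  gcongr
  exact norm_setIntegral_le_of_norm_le_const hP.measure_lt_top fun x _ => hM x ω

/-- Second moment of an integral of a bounded random field in terms of its covariance. -/
lemma integral_sq_setIntegral_le [IsProbabilityMeasure (volume : Measure Ω)]
    {F : ℝ × ℝ → Ω → ℝ} {M B : ℝ} {P : Set (ℝ × ℝ)}
    {S : ℝ × ℝ → ℝ × ℝ → ℝ}
    (hP : IsCompact P) (hF : Measurable (fun p : (ℝ × ℝ) × Ω => F p.1 p.2))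
    (hM : ∀ x ω, |F x ω| ≤ M)
    (hS : ∀ x y, |∫ ω, F x ω * F y ω| ≤ S x y)
    (hSm : Measurable fun p : (ℝ × ℝ) × (ℝ × ℝ) => S p.1 p.2)
    (hSb : ∀ x y, |S x y| ≤ M ^ 2)
    (hB : ∀ x ∈ P, ∫ y in P, S x y ≤ B) :
    ∫ ω, (∫ x in P, F x ω) ^ 2 ≤ B * volume.real P := by
  set μ : Measure (ℝ × ℝ) := volume.restrict P with hμ
  have : IsFiniteMeasure μ := ⟨by rw [hμ, Measure.restrict_apply_univ]; exact hP.measure_lt_top⟩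
  have hSint : Integrable (fun p : (ℝ × ℝ) × (ℝ × ℝ) => S p.1 p.2) (μ.prod μ) :=
    Integrable.of_bound hSm.aestronglyMeasurable (M ^ 2)
      (Filter.Eventually.of_forall fun p => hSb _ _)
  have hmeas : Measurable fun z : Ω × ((ℝ × ℝ) × (ℝ × ℝ)) => F z.2.1 z.1 * F z.2.2 z.1 :=
    (hF.comp (by fun_prop : Measurable fun z : Ω × ((ℝ × ℝ) × (ℝ × ℝ)) => (z.2.1, z.1))).mul
      (hF.comp (by fun_prop : Measurable fun z : Ω × ((ℝ × ℝ) × (ℝ × ℝ)) => (z.2.2, z.1)))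
  have hintegrable : Integrable (fun z : Ω × ((ℝ × ℝ) × (ℝ × ℝ)) => F z.2.1 z.1 * F z.2.2 z.1)
      ((volume : Measure Ω).prod (μ.prod μ)) := by
    refine Integrable.of_bound hmeas.aestronglyMeasurable (M * M)
      (Filter.Eventually.of_forall fun z => ?_)
    rw [norm_mul]
    exact mul_le_mul (hM _ _) (hM _ _) (norm_nonneg _) ((abs_nonneg _).trans (hM z.2.1 z.1))
  calc ∫ ω, (∫ x in P, F x ω) ^ 2
      = ∫ ω, ∫ p : (ℝ × ℝ) × (ℝ × ℝ), F p.1 ω * F p.2 ω ∂(μ.prod μ) := by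
        refine integral_congr_ae (Filter.Eventually.of_forall fun ω => ?_)
        simp only
        rw [integral_prod_mul (fun x => F x ω) (fun x => F x ω), sq]
    _ = ∫ p : (ℝ × ℝ) × (ℝ × ℝ), (∫ ω, F p.1 ω * F p.2 ω) ∂(μ.prod μ) :=
        integral_integral_swap hintegrable
    _ ≤ ∫ p : (ℝ × ℝ) × (ℝ × ℝ), S p.1 p.2 ∂(μ.prod μ) :=
        integral_mono hintegrable.integral_prod_right hSint
          fun p => (le_abs_self _).trans (hS _ _)
    _ = ∫ x in P, ∫ y in P, S x y := integral_prod _ hSint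
    _ ≤ ∫ _ in P, B := by
        refine integral_mono_ae hSint.integral_prod_left (integrable_const B) ?_
        filter_upwards [ae_restrict_mem hP.measurableSet] with x hx using hB x hx
    _ = B * volume.real P := by
        rw [setIntegral_const, smul_eq_mul, mul_comm]

end Moments

lemma measurable_mul_hat {Q : ℝ × ℝ → ℝ} (hQ : Measurable Q) (h : ℝ) (p r : ℤ × ℤ) :
    Measurable fun x => Q x * hat h p x * hat h r x :=
  (hQ.mul (measurable_hat h p)).mul (measurable_hat h r)

lemma abs_mul_hat_le (c h : ℝ) (p r : ℤ × ℤ) (x : ℝ × ℝ) :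
    |c * hat h p x * hat h r x| ≤ |c| := by
  rw [abs_mul, abs_mul, abs_of_nonneg (hat_nonneg h p x), abs_of_nonneg (hat_nonneg h r x)]
  exact (mul_le_of_le_one_right (mul_nonneg (abs_nonneg _) (hat_nonneg h p x))
    (hat_le_one h r x)).trans (mul_le_of_le_one_right (abs_nonneg _) (hat_le_one h p x))

/-- Perturbing the potential by `Q` perturbs the stiffness matrix by local averages of `Q`. -/
lemma abs_stiff_sub_le {h δ M : ℝ} (hh : 0 < h) (hδ : 0 < δ) (N : ℕ) (q₀ : ℝ × ℝ → ℝ)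
    {Q : ℝ × ℝ → ℝ} (hQ : Measurable Q) (hM : ∀ x, |Q x| ≤ M) (p r : ℤ × ℤ) :
    |stiff h δ N (fun x => q₀ x + Q x) p r - stiff h δ N q₀ p r| ≤
      ∑ t : Fin N × Fin N × Bool,
        (h / δ) ^ 2 * |∫ x in patch h δ t.1 t.2.1 t.2.2, Q x * hat h p x * hat h r x| := by
  unfold stiff
  rw [← Finset.sum_sub_distrib]
  refine (Finset.abs_sum_le_sum_abs _ _).trans (Finset.sum_le_sum fun t _ => ?_)
  rw [← mul_sub, abs_mul, abs_of_nonneg (volume_ratio_nonneg h δ t.1 t.2.1 t.2.2)]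
  refine mul_le_mul (volume_ratio_le hh hδ _ _ _) ?_ (abs_nonneg _) (by positivity)
  have hintegrable : Integrable (fun x => Q x * hat h p x * hat h r x)
      (volume.restrict (patch h δ t.1 t.2.1 t.2.2)) :=
    Measure.integrableOn_of_bounded (M := M) (isCompact_patch _ _ _ _ _).measure_lt_top.ne
      (measurable_mul_hat hQ h p r).aestronglyMeasurable
      (Filter.Eventually.of_forall fun x => (abs_mul_hat_le _ h p r x).trans (hM x))
  have := abs_integral_add_sub_le (f := fun x => gradDot (hat h p) (hat h r) x +
    q₀ x * hat h p x * hat h r x) hintegrable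
  simpa only [add_mul, add_assoc] using this

/-- Only the vertices of a cell contribute to integrals over its patches. -/
lemma sum_abs_setIntegral_le {h δ : ℝ} (hh : 0 < h) (hδ : 0 < δ) (hδh : δ ≤ h)
    (I : Finset (ℤ × ℤ)) (Q : ℝ × ℝ → ℝ) (i j : ℕ) (b : Bool) :
    ∑ z ∈ I ×ˢ I, |∫ x in patch h δ i j b, Q x * hat h z.1 x * hat h z.2 x| ≤
      ∑ z ∈ cellNodes i j ×ˢ cellNodes i j,
        |∫ x in patch h δ i j b, Q x * hat h z.1 x * hat h z.2 x| := by
  rw [← Finset.sum_filter_of_ne (p := (· ∈ cellNodes i j ×ˢ cellNodes i j))]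
  · exact Finset.sum_le_sum_of_subset_of_nonneg
      (fun z hz => (Finset.mem_filter.1 hz).2) fun _ _ _ => abs_nonneg _
  intro z _ hz
  by_contra hmem
  apply hz
  rw [setIntegral_eq_zero_of_forall_eq_zero, abs_zero]
  intro x hx
  rw [Finset.mem_product, not_and_or] at hmem
  rcases hmem with h' | h' <;> simp [hat_eq_zero_on_patch hh hδ hδh h' hx]

/-- If `G` is a left inverse of `A₀` and `A U = A₀ U₀`, then `U - U₀` is controlled by the entries
of `A - A₀`. -/
lemma abs_sub_le_of_leftInverse {ι : Type*} [DecidableEq ι] {I : Finset ι} {A A₀ G : ι → ι → ℝ}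
    {U U₀ F : ι → ℝ} {a b : ℝ} (ha : 0 ≤ a)
    (hU : ∀ i ∈ I, ∑ k ∈ I, A i k * U k = F i) (hU₀ : ∀ i ∈ I, ∑ k ∈ I, A₀ i k * U₀ k = F i)
    (hG : ∀ i ∈ I, ∀ m ∈ I, ∑ k ∈ I, G i k * A₀ k m = if i = m then 1 else 0)
    (hGa : ∀ i ∈ I, ∀ k ∈ I, |G i k| ≤ a) (hUb : ∀ k ∈ I, |U k| ≤ b) {i : ι} (hi : i ∈ I) :
    |U i - U₀ i| ≤ a * b * ∑ z ∈ I ×ˢ I, |A z.1 z.2 - A₀ z.1 z.2| := by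
  have hres : ∀ k ∈ I, ∑ m ∈ I, A₀ k m * (U m - U₀ m) =
      -∑ m ∈ I, (A k m - A₀ k m) * U m := fun k hk => by
    simp only [mul_sub, sub_mul, Finset.sum_sub_distrib, hU k hk, hU₀ k hk]
    ring
  have hrep : U i - U₀ i = ∑ k ∈ I, G i k * -∑ m ∈ I, (A k m - A₀ k m) * U m := by
    calc U i - U₀ i = ∑ m ∈ I, (if i = m then 1 else 0) * (U m - U₀ m) := by
          simp [hi]
      _ = ∑ m ∈ I, (∑ k ∈ I, G i k * A₀ k m) * (U m - U₀ m) :=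
          Finset.sum_congr rfl fun m hm => by rw [hG i hi m hm]
      _ = ∑ k ∈ I, G i k * ∑ m ∈ I, A₀ k m * (U m - U₀ m) := by
          simp only [Finset.sum_mul, Finset.mul_sum, mul_assoc]
          exact Finset.sum_comm
      _ = _ := Finset.sum_congr rfl fun k hk => by rw [hres k hk]
  rw [hrep, Finset.sum_product, Finset.mul_sum]
  refine (Finset.abs_sum_le_sum_abs _ _).trans (Finset.sum_le_sum fun k hk => ?_)
  rw [abs_mul, abs_neg, mul_assoc]
  refine mul_le_mul (hGa i hi k hk) ?_ (abs_nonneg _) ha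
  rw [Finset.mul_sum]
  refine (Finset.abs_sum_le_sum_abs _ _).trans (Finset.sum_le_sum fun m hm => ?_)
  rw [abs_mul, mul_comm]
  exact mul_le_mul_of_nonneg_right (hUb m hm) (abs_nonneg _)

/-- The sum of the squared fluctuations of `Q` over all patches, tested against products of
hat functions. -/
def fluctuation (h δ : ℝ) (N : ℕ) (Q : ℝ × ℝ → ℝ) : ℝ :=
  ∑ t : Fin N × Fin N × Bool, ∑ z ∈ cellNodes t.1 t.2.1 ×ˢ cellNodes t.1 t.2.1,
    (∫ x in patch h δ t.1 t.2.1 t.2.2, Q x * hat h z.1 x * hat h z.2 x) ^ 2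

lemma sq_sum_abs_stiff_sub_le {h δ M : ℝ} (hh : 0 < h) (hδ : 0 < δ) (hδh : δ ≤ h) (N : ℕ)
    (q₀ : ℝ × ℝ → ℝ) {Q : ℝ × ℝ → ℝ} (hQ : Measurable Q) (hM : ∀ x, |Q x| ≤ M)
    (I : Finset (ℤ × ℤ)) :
    (∑ z ∈ I ×ˢ I, |stiff h δ N (fun x => q₀ x + Q x) z.1 z.2 - stiff h δ N q₀ z.1 z.2|) ^ 2 ≤
      32 * (N : ℝ) ^ 2 * (h / δ) ^ 4 * fluctuation h δ N Q := by
  set J : Fin N × Fin N × Bool → (ℤ × ℤ) × (ℤ × ℤ) → ℝ := fun t z =>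
    ∫ x in patch h δ t.1 t.2.1 t.2.2, Q x * hat h z.1 x * hat h z.2 x with hJ
  have h1 : ∑ z ∈ I ×ˢ I, |stiff h δ N (fun x => q₀ x + Q x) z.1 z.2 - stiff h δ N q₀ z.1 z.2| ≤
      (h / δ) ^ 2 * ∑ t : Fin N × Fin N × Bool,
        ∑ z ∈ cellNodes t.1 t.2.1 ×ˢ cellNodes t.1 t.2.1, |J t z| := by
    calc _ ≤ ∑ z ∈ I ×ˢ I, ∑ t : Fin N × Fin N × Bool, (h / δ) ^ 2 * |J t z| :=
          Finset.sum_le_sum fun z _ => abs_stiff_sub_le hh hδ N q₀ hQ hM z.1 z.2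
      _ = (h / δ) ^ 2 * ∑ t : Fin N × Fin N × Bool, ∑ z ∈ I ×ˢ I, |J t z| := by
          rw [Finset.sum_comm]
          simp only [Finset.mul_sum]
      _ ≤ _ := by
          refine mul_le_mul_of_nonneg_left (Finset.sum_le_sum fun t _ => ?_) (by positivity)
          exact sum_abs_setIntegral_le hh hδ hδh I Q t.1 t.2.1 t.2.2
  have h2 : (∑ t : Fin N × Fin N × Bool,
      ∑ z ∈ cellNodes t.1 t.2.1 ×ˢ cellNodes t.1 t.2.1, |J t z|) ^ 2 ≤
      32 * (N : ℝ) ^ 2 * fluctuation h δ N Q := by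
    calc _ ≤ ((Finset.univ : Finset (Fin N × Fin N × Bool)).card : ℝ) *
            ∑ t : Fin N × Fin N × Bool,
              (∑ z ∈ cellNodes t.1 t.2.1 ×ˢ cellNodes t.1 t.2.1, |J t z|) ^ 2 :=
          sq_sum_le_card_mul_sum_sq
      _ ≤ ((Finset.univ : Finset (Fin N × Fin N × Bool)).card : ℝ) *
            ∑ t : Fin N × Fin N × Bool,
              16 * ∑ z ∈ cellNodes t.1 t.2.1 ×ˢ cellNodes t.1 t.2.1, J t z ^ 2 := by
          gcongr with t
          refine sq_sum_le_card_mul_sum_sq.trans_eq ?_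
          simp only [Finset.card_product, card_cellNodes, sq_abs]
          norm_num
      _ = _ := by
          rw [← Finset.mul_sum]
          simp only [Finset.card_univ, Fintype.card_prod, Fintype.card_fin, Fintype.card_bool,
            fluctuation, hJ]
          push_cast
          ring
  calc _ ≤ ((h / δ) ^ 2 * ∑ t : Fin N × Fin N × Bool,
        ∑ z ∈ cellNodes t.1 t.2.1 ×ˢ cellNodes t.1 t.2.1, |J t z|) ^ 2 :=
        pow_le_pow_left₀ (Finset.sum_nonneg fun _ _ => abs_nonneg _) h1 2
    _ = (h / δ) ^ 4 * (∑ t : Fin N × Fin N × Bool,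
        ∑ z ∈ cellNodes t.1 t.2.1 ×ˢ cellNodes t.1 t.2.1, |J t z|) ^ 2 := by ring
    _ ≤ (h / δ) ^ 4 * (32 * (N : ℝ) ^ 2 * fluctuation h δ N Q) := by gcongr
    _ = _ := by ring

lemma card_nodes_le {N : ℕ} (hN : 0 < N) : ((nodes N).card : ℝ) ≤ (N : ℝ) ^ 2 := by
  have : (nodes N).card ≤ N ^ 2 := by
    simp only [nodes, Finset.card_product, Int.card_Icc, sq]
    exact Nat.mul_le_mul (by omega) (by omega)
  exact_mod_cast this

section Field

variable {Ω : Type} [MeasureSpace Ω] [IsProbabilityMeasure (volume : Measure Ω)]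
  {q : ℝ × ℝ → Ω → ℝ} {M : ℝ}

lemma measurable_scaled_mul_hat {Ω : Type} [MeasurableSpace Ω] {q : ℝ × ℝ → Ω → ℝ}
    (hq : Measurable (fun p : (ℝ × ℝ) × Ω => q p.1 p.2)) (ε h : ℝ) (p r : ℤ × ℤ) :
    Measurable (fun z : (ℝ × ℝ) × Ω => q (ε⁻¹ • z.1) z.2 * hat h p z.1 * hat h r z.1) := by
  have h1 : Measurable fun z : (ℝ × ℝ) × Ω => q (ε⁻¹ • z.1) z.2 :=
    hq.comp (by fun_prop : Measurable fun z : (ℝ × ℝ) × Ω => (ε⁻¹ • z.1, z.2))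
  exact (h1.mul ((measurable_hat h p).comp measurable_fst)).mul
    ((measurable_hat h r).comp measurable_fst)

lemma integrable_fluctuation (hq : Measurable (fun p : (ℝ × ℝ) × Ω => q p.1 p.2))
    (hM : ∀ x ω, |q x ω| ≤ M) (ε h δ : ℝ) (N : ℕ) :
    Integrable fun ω => fluctuation h δ N fun x => q (ε⁻¹ • x) ω :=
  integrable_finsetSum _ fun _ _ => integrable_finsetSum _ fun z _ =>
    integrable_sq_setIntegral (isCompact_patch _ _ _ _ _)
      (measurable_scaled_mul_hat hq ε h z.1 z.2)
      fun x ω => (abs_mul_hat_le _ h z.1 z.2 x).trans (hM (ε⁻¹ • x) ω)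

/-- Second moment of a patch average of a field with heavy-tailed correlations. -/
lemma integral_sq_patch_le {R : ℝ × ℝ → ℝ} {α κ ε h δ : ℝ} (hα0 : 0 < α) (hα2 : α < 2)
    (hκ : 0 < κ) (hq : Measurable (fun p : (ℝ × ℝ) × Ω => q p.1 p.2))
    (hM : ∀ x ω, |q x ω| ≤ M) (hcov : ∀ x y : ℝ × ℝ, ∫ ω, q x ω * q y ω = R (x - y))
    (hR : ∀ z : ℝ × ℝ, z ≠ 0 → |R z| ≤ κ * Real.sqrt (z.1 ^ 2 + z.2 ^ 2) ^ (-α))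
    (hε : 0 < ε) (hh : 0 < h) (hδ : 0 < δ) (i j : ℕ) (b : Bool) (p r : ℤ × ℤ) :
    ∫ ω, (∫ x in patch h δ i j b, q (ε⁻¹ • x) ω * hat h p x * hat h r x) ^ 2 ≤
      64 * κ / (1 - α / 2) ^ 2 * ε ^ α * δ ^ (4 - α) := by
  have hcov' : ∀ x y : ℝ × ℝ, R (ε⁻¹ • x - ε⁻¹ • y) = ∫ ω, q (ε⁻¹ • x) ω * q (ε⁻¹ • y) ω :=
    fun x y => (hcov _ _).symm
  have hbd : ∀ x y : ℝ × ℝ, |R (ε⁻¹ • x - ε⁻¹ • y)| ≤ M ^ 2 := fun x y => by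
    rw [hcov']
    have hpt : ∀ ω, ‖q (ε⁻¹ • x) ω * q (ε⁻¹ • y) ω‖ ≤ M ^ 2 := fun ω => by
      rw [norm_mul, sq]
      exact mul_le_mul (hM _ _) (hM _ _) (norm_nonneg _) ((abs_nonneg _).trans (hM x ω))
    simpa using norm_integral_le_of_norm_le_const (μ := (volume : Measure Ω))
      (Filter.Eventually.of_forall hpt)
  have hmeas : Measurable fun z : (ℝ × ℝ) × (ℝ × ℝ) => |R (ε⁻¹ • z.1 - ε⁻¹ • z.2)| := by
    simp only [hcov']
    have h1 : Measurable fun w : ((ℝ × ℝ) × (ℝ × ℝ)) × Ω =>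
        q (ε⁻¹ • w.1.1) w.2 * q (ε⁻¹ • w.1.2) w.2 :=
      (hq.comp (by fun_prop : Measurable fun w : ((ℝ × ℝ) × (ℝ × ℝ)) × Ω =>
        (ε⁻¹ • w.1.1, w.2))).mul
      (hq.comp (by fun_prop : Measurable fun w : ((ℝ × ℝ) × (ℝ × ℝ)) × Ω =>
        (ε⁻¹ • w.1.2, w.2)))
    exact (StronglyMeasurable.integral_prod_right (ν := (volume : Measure Ω))
      (f := fun (z : (ℝ × ℝ) × (ℝ × ℝ)) ω => q (ε⁻¹ • z.1) ω * q (ε⁻¹ • z.2) ω)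
      h1.stronglyMeasurable).measurable.abs
  have key := integral_sq_setIntegral_le (M := M)
    (F := fun x ω => q (ε⁻¹ • x) ω * hat h p x * hat h r x)
    (S := fun x y => |R (ε⁻¹ • x - ε⁻¹ • y)|)
    (isCompact_patch h δ i j b) (measurable_scaled_mul_hat hq ε h p r)
    (fun x ω => (abs_mul_hat_le _ h p r x).trans (hM (ε⁻¹ • x) ω))
    (fun x y => by
      have : ∀ ω, q (ε⁻¹ • x) ω * hat h p x * hat h r x *
          (q (ε⁻¹ • y) ω * hat h p y * hat h r y) =
          (q (ε⁻¹ • x) ω * q (ε⁻¹ • y) ω) * (hat h p x * hat h r x * hat h p y * hat h r y) :=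
        fun ω => by ring
      simp only [this]
      rw [integral_mul_const, ← hcov', ← mul_assoc, ← mul_assoc, ← mul_assoc]
      exact (abs_mul_hat_le _ h p r y).trans (abs_mul_hat_le _ h p r x))
    hmeas (fun x y => by rw [abs_abs]; exact hbd x y)
    (fun x hx => setIntegral_abs_correlation_le hα0 hα2 hκ hR hε hδ
      (isCompact_patch h δ i j b).measurableSet (patch_subset_box hh hδ i j b) hx)
  refine key.trans ((mul_le_mul_of_nonneg_left (volume_patch_le hh hδ i j b) ?_).trans_eq ?_)
  · positivity
  · have : δ ^ (4 - α) = δ ^ (2 - α) * δ ^ 2 := by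
      rw [← Real.rpow_natCast, ← Real.rpow_add hδ]; congr 1; push_cast; ring
    rw [this]
    ring

lemma integral_fluctuation_le {R : ℝ × ℝ → ℝ} {α κ ε h δ : ℝ} (hα0 : 0 < α) (hα2 : α < 2)
    (hκ : 0 < κ) (hq : Measurable (fun p : (ℝ × ℝ) × Ω => q p.1 p.2))
    (hM : ∀ x ω, |q x ω| ≤ M) (hcov : ∀ x y : ℝ × ℝ, ∫ ω, q x ω * q y ω = R (x - y))
    (hR : ∀ z : ℝ × ℝ, z ≠ 0 → |R z| ≤ κ * Real.sqrt (z.1 ^ 2 + z.2 ^ 2) ^ (-α))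
    (hε : 0 < ε) (hh : 0 < h) (hδ : 0 < δ) (N : ℕ) :
    ∫ ω, fluctuation h δ N (fun x => q (ε⁻¹ • x) ω) ≤
      32 * (N : ℝ) ^ 2 * (64 * κ / (1 - α / 2) ^ 2 * ε ^ α * δ ^ (4 - α)) := by
  have hintegrable : ∀ (t : Fin N × Fin N × Bool) (z : (ℤ × ℤ) × (ℤ × ℤ)), Integrable fun ω =>
      (∫ x in patch h δ t.1 t.2.1 t.2.2, q (ε⁻¹ • x) ω * hat h z.1 x * hat h z.2 x) ^ 2 :=
    fun t z => integrable_sq_setIntegral (isCompact_patch _ _ _ _ _)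
      (measurable_scaled_mul_hat hq ε h z.1 z.2)
      fun x ω => (abs_mul_hat_le _ h z.1 z.2 x).trans (hM (ε⁻¹ • x) ω)
  unfold fluctuation
  rw [integral_finsetSum _ fun t _ => integrable_finsetSum _ fun z _ => hintegrable t z]
  calc _ ≤ ∑ t : Fin N × Fin N × Bool, ∑ z ∈ cellNodes t.1 t.2.1 ×ˢ cellNodes t.1 t.2.1,
        64 * κ / (1 - α / 2) ^ 2 * ε ^ α * δ ^ (4 - α) := by
        refine Finset.sum_le_sum fun t _ => ?_
        rw [integral_finsetSum _ fun z _ => hintegrable t z]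
        exact Finset.sum_le_sum fun z _ =>
          integral_sq_patch_le hα0 hα2 hκ hq hM hcov hR hε hh hδ _ _ _ _ _
    _ = _ := by
        simp only [Finset.sum_const, Finset.card_product, card_cellNodes, Finset.card_univ,
          Fintype.card_prod, Fintype.card_fin, Fintype.card_bool, nsmul_eq_mul]
        push_cast
        ring

end Field

/-- Lemma 4.1, part (2) (long-range correlations, `d = 2`): under the
heavy-tail condition `|R(z)| ≤ κ|z|^{−α}` and the a priori bounds `|D⁻ₛG| ≤ Ch^{γ₁}`,
`|D⁻ₛU^ε| ≤ Ch^{γ₂}`, `|G| ≤ Ch^{γ₃}`, `|U^ε| ≤ Ch^{γ₄}`, the discrete corrector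
satisfies `E‖U^ε − U⁰‖²_{ℓ²} ≤ C′ h^{2 min(γ₁+γ₂, γ₃+γ₄) − 2} (ε/δ)^α`, with `C′`
depending only on `C`, `α` and `κ`. -/
theorem stmt15 (C : ℝ) (hC : 0 < C) (α κ : ℝ) (hα0 : 0 < α) (hα2 : α < 2) (hκ : 0 < κ) :
    ∃ C' : ℝ, 0 < C' ∧
      ∀ (Ω : Type) [MeasureSpace Ω] [IsProbabilityMeasure (volume : Measure Ω)],
      ∀ (q : ℝ × ℝ → Ω → ℝ) (R : ℝ × ℝ → ℝ) (M : ℝ),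
        Measurable (fun p : (ℝ × ℝ) × Ω => q p.1 p.2) →
        (∀ x ω, |q x ω| ≤ M) →
        (∀ x, ∫ ω, q x ω = 0) →
        (∀ x y : ℝ × ℝ, ∫ ω, q x ω * q y ω = R (x - y)) →
        (∀ z : ℝ × ℝ, z ≠ 0 → |R z| ≤ κ * Real.sqrt (z.1 ^ 2 + z.2 ^ 2) ^ (-α)) →
      ∀ (N : ℕ), 0 < N → ∀ (h δ : ℝ), h = 1 / N → 0 < δ → δ ≤ h →
      ∀ (q₀ : ℝ × ℝ → ℝ), Measurable q₀ → (∃ M₀ : ℝ, ∀ x, |q₀ x| ≤ M₀) →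
        (∀ x, 0 ≤ q₀ x) →
      ∀ (ε : ℝ), 0 < ε →
        (∀ᵐ ω ∂(volume : Measure Ω), ∀ᵐ x ∂(volume.restrict Ysq),
          0 ≤ q₀ x + q (ε⁻¹ • x) ω) →
      ∀ (f : ℝ × ℝ → ℝ), Measurable f → (∃ Mf : ℝ, ∀ x, |f x| ≤ Mf) →
      ∀ (Uε : Ω → ℤ × ℤ → ℝ) (U0 : ℤ × ℤ → ℝ) (G : ℤ × ℤ → ℤ × ℤ → ℝ),
        (∀ ij, Measurable fun ω => Uε ω ij) →
        (∀ ω, ∀ kl, kl ∉ nodes N → Uε ω kl = 0) →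
        (∀ kl, kl ∉ nodes N → U0 kl = 0) →
        (∀ ω, ∀ ij ∈ nodes N,
          ∑ kl ∈ nodes N,
            stiff h δ N (fun x => q₀ x + q (ε⁻¹ • x) ω) ij kl * Uε ω kl = load h f ij) →
        (∀ ij ∈ nodes N, ∑ kl ∈ nodes N, stiff h δ N q₀ ij kl * U0 kl = load h f ij) →
        (∀ ij kl, (ij ∉ nodes N ∨ kl ∉ nodes N) → G ij kl = 0) →
        (∀ ij ∈ nodes N, ∀ mn ∈ nodes N,
          ∑ kl ∈ nodes N, G ij kl * stiff h δ N q₀ kl mn = if ij = mn then 1 else 0) →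
      ∀ (γ₁ γ₂ γ₃ γ₄ : ℝ),
        (∀ ω, ∀ s : Fin 3, ∀ ij ∈ nodes N, ∀ kl ∈ nodes N,
          |G ij kl - G ij (dm s kl)| ≤ C * h ^ γ₁ ∧
          |Uε ω ij - Uε ω (dm s ij)| ≤ C * h ^ γ₂ ∧
          |G ij kl| ≤ C * h ^ γ₃ ∧ |Uε ω ij| ≤ C * h ^ γ₄) →
        ∫ ω, ∑ ij ∈ nodes N, (Uε ω ij - U0 ij) ^ 2 ≤
          C' * h ^ (2 * min (γ₁ + γ₂) (γ₃ + γ₄) - 2) * (ε / δ) ^ α := by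
  refine ⟨65536 * C ^ 4 * κ / (1 - α / 2) ^ 2, ?_, ?_⟩
  · have : 0 < 1 - α / 2 := by linarith
    positivity
  intro Ω _ _ q R M hq hM _ hcov hR N hN h δ hhN hδ hδh q₀ _ _ _ ε hε _ f _ _ Uε U0 G _ _ _
    hUε hU0 _ hG γ₁ γ₂ γ₃ γ₄ hbounds
  have hN' : (0 : ℝ) < N := Nat.cast_pos.2 hN
  have hh : 0 < h := by rw [hhN]; positivity
  have hh1 : h ≤ 1 := by
    rw [hhN, div_le_one hN']
    exact_mod_cast hN
  set Φ : Ω → ℝ := fun ω => fluctuation h δ N fun x => q (ε⁻¹ • x) ω with hΦ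
  set a : ℝ := C * h ^ γ₃ with ha
  set b : ℝ := C * h ^ γ₄ with hb
  have ha0 : 0 ≤ a := by positivity
  have hb0 : 0 ≤ b := by positivity
  have hpath : ∀ ω, ∑ ij ∈ nodes N, (Uε ω ij - U0 ij) ^ 2 ≤
      (N : ℝ) ^ 2 * ((a * b) ^ 2 * (32 * (N : ℝ) ^ 2 * (h / δ) ^ 4)) * Φ ω := fun ω => by
    have hQ : Measurable fun x : ℝ × ℝ => q (ε⁻¹ • x) ω :=
      hq.comp (by fun_prop : Measurable fun x : ℝ × ℝ => (ε⁻¹ • x, ω))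
    have hsq := sq_sum_abs_stiff_sub_le hh hδ hδh N q₀ hQ (fun x => hM (ε⁻¹ • x) ω) (nodes N)
    have hΦ0 : 0 ≤ Φ ω := Finset.sum_nonneg fun _ _ => Finset.sum_nonneg fun _ _ => sq_nonneg _
    have hentry : ∀ ij ∈ nodes N, (Uε ω ij - U0 ij) ^ 2 ≤
        (a * b) ^ 2 * (32 * (N : ℝ) ^ 2 * (h / δ) ^ 4) * Φ ω := fun ij hij => by
      have := abs_sub_le_of_leftInverse ha0 (hUε ω) hU0 hG
        (fun i hi k hk => (hbounds ω 0 i hi k hk).2.2.1)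
        (fun k hk => (hbounds ω 0 k hk k hk).2.2.2) hij
      rw [← sq_abs]
      refine (pow_le_pow_left₀ (abs_nonneg _) this 2).trans ?_
      rw [mul_pow (a * b), mul_assoc ((a * b) ^ 2)]
      exact mul_le_mul_of_nonneg_left hsq (sq_nonneg _)
    refine (Finset.sum_le_card_nsmul _ _ _ hentry).trans ?_
    rw [nsmul_eq_mul, mul_assoc ((N : ℝ) ^ 2)]
    exact mul_le_mul_of_nonneg_right (card_nodes_le hN) (by positivity)
  have hexp : (h ^ γ₃ * h ^ γ₄) ^ 2 ≤ h ^ (2 * min (γ₁ + γ₂) (γ₃ + γ₄)) := by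
    rw [← Real.rpow_add hh, ← Real.rpow_natCast, ← Real.rpow_mul hh.le]
    refine Real.rpow_le_rpow_of_exponent_ge hh hh1 ?_
    push_cast
    linarith [min_le_right (γ₁ + γ₂) (γ₃ + γ₄)]
  have hNh : (N : ℝ) = h⁻¹ := by rw [hhN]; simp
  calc ∫ ω, ∑ ij ∈ nodes N, (Uε ω ij - U0 ij) ^ 2
      ≤ ∫ ω, (N : ℝ) ^ 2 * ((a * b) ^ 2 * (32 * (N : ℝ) ^ 2 * (h / δ) ^ 4)) * Φ ω :=
        integral_mono_of_nonneg
          (Filter.Eventually.of_forall fun ω => Finset.sum_nonneg fun _ _ => sq_nonneg _)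
          ((integrable_fluctuation hq hM ε h δ N).const_mul _)
          (Filter.Eventually.of_forall hpath)
    _ ≤ (N : ℝ) ^ 2 * ((a * b) ^ 2 * (32 * (N : ℝ) ^ 2 * (h / δ) ^ 4)) *
          (32 * (N : ℝ) ^ 2 * (64 * κ / (1 - α / 2) ^ 2 * ε ^ α * δ ^ (4 - α))) := by
        rw [integral_const_mul]
        gcongr
        exact integral_fluctuation_le hα0 hα2 hκ hq hM hcov hR hε hh hδ N
    _ = 65536 * C ^ 4 * κ / (1 - α / 2) ^ 2 * ((h ^ γ₃ * h ^ γ₄) ^ 2 * (h ^ 2)⁻¹) *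
          (ε / δ) ^ α := by
        have hδα : δ ^ (4 - α) = δ ^ 4 / δ ^ α := by
          rw [Real.rpow_sub hδ]; norm_cast
        rw [hδα, Real.div_rpow hε.le hδ.le, hNh, ha, hb]
        field_simp
        ring
    _ ≤ 65536 * C ^ 4 * κ / (1 - α / 2) ^ 2 *
          (h ^ (2 * min (γ₁ + γ₂) (γ₃ + γ₄)) * (h ^ 2)⁻¹) * (ε / δ) ^ α := by
        gcongr
    _ = _ := by
        rw [Real.rpow_sub hh, Real.rpow_two, div_eq_mul_inv (h ^ _)]
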